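/- Let n = 4 and let C be a Weyl candidate on 4-dimensional Minkowski space. Then its generalized Bel–Robinson tensor 𝒯 is completely symmetric: 𝒯_{αβλμ} is invariant under every permutation of the four indices (α, β, λ, μ). -/

import Mathlib

open Finset

noncomputable section

/-- Components of the Minkowski metric (and of its inverse) in dimension `n`. -/
def gmet (n : ℕ) (μ ν : Fin n) : ℝ :=
  if μ = ν then (if (μ : ℕ) = 0 then -1 else 1) else 0

/-- A Weyl candidate: pair antisymmetries, pair interchange symmetry,
first Bianchi identity, and trace-free. -/
def IsWeylCandidate (n : ℕ) (C : Fin n → Fin n → Fin n → Fin n → ℝ) : Prop :=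
  (∀ a b c d, C a b c d = - C b a c d) ∧
  (∀ a b c d, C a b c d = - C a b d c) ∧
  (∀ a b c d, C a b c d = C c d a b) ∧
  (∀ a b c d, C a b c d + C a c d b + C a d b c = 0) ∧
  (∀ b d, (∑ a : Fin n, ∑ c : Fin n, gmet n a c * C a b c d) = 0)

/-- The generalized Bel(-Robinson) tensor of a double symmetric `(2,2)`-form `C`:
`𝒯_{αβλμ} = C_{αρλσ} C_β{}^ρ{}_μ{}^σ + C_{αρμσ} C_β{}^ρ{}_λ{}^σ
  − (1/2)η_{αβ} C_{ρτλσ} C^{ρτ}{}_μ{}^σ − (1/2)η_{λμ} C_{αρστ} C_β{}^{ρστ}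
  + (1/8)η_{αβ}η_{λμ} C_{ρτσν} C^{ρτσν}`. -/
def belT (n : ℕ) (C : Fin n → Fin n → Fin n → Fin n → ℝ) (α β lam mu : Fin n) : ℝ :=
  (∑ ρ : Fin n, ∑ ρ' : Fin n, ∑ σ : Fin n, ∑ σ' : Fin n,
      gmet n ρ ρ' * gmet n σ σ' * C α ρ lam σ * C β ρ' mu σ')
  + (∑ ρ : Fin n, ∑ ρ' : Fin n, ∑ σ : Fin n, ∑ σ' : Fin n,
      gmet n ρ ρ' * gmet n σ σ' * C α ρ mu σ * C β ρ' lam σ')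
  - (1 / 2) * gmet n α β *
      (∑ ρ : Fin n, ∑ ρ' : Fin n, ∑ τ : Fin n, ∑ τ' : Fin n, ∑ σ : Fin n, ∑ σ' : Fin n,
        gmet n ρ ρ' * gmet n τ τ' * gmet n σ σ' * C ρ τ lam σ * C ρ' τ' mu σ')
  - (1 / 2) * gmet n lam mu *
      (∑ ρ : Fin n, ∑ ρ' : Fin n, ∑ σ : Fin n, ∑ σ' : Fin n, ∑ τ : Fin n, ∑ τ' : Fin n,
        gmet n ρ ρ' * gmet n σ σ' * gmet n τ τ' * C α ρ σ τ * C β ρ' σ' τ')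
  + (1 / 8) * gmet n α β * gmet n lam mu *
      (∑ ρ : Fin n, ∑ ρ' : Fin n, ∑ τ : Fin n, ∑ τ' : Fin n, ∑ σ : Fin n, ∑ σ' : Fin n,
       ∑ ν : Fin n, ∑ ν' : Fin n,
        gmet n ρ ρ' * gmet n τ τ' * gmet n σ σ' * gmet n ν ν' * C ρ τ σ ν * C ρ' τ' σ' ν')

/-- The sign `η_{aa}`. -/
def sgn4 (a : Fin 4) : ℝ := if (a : ℕ) = 0 then -1 else 1

theorem gmet_eq (a b : Fin 4) : gmet 4 a b = if a = b then sgn4 a else 0 := rfl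

/-- The contraction `C_{αρλσ} C_β{}^ρ{}_μ{}^σ`. -/
def dcon (C : Fin 4 → Fin 4 → Fin 4 → Fin 4 → ℝ) (a b l m : Fin 4) : ℝ :=
  ∑ r, ∑ s, sgn4 r * sgn4 s * C a r l s * C b r m s

/-- The contraction `C_{αρστ} C_β{}^{ρστ}`. -/
def tcon (C : Fin 4 → Fin 4 → Fin 4 → Fin 4 → ℝ) (a b : Fin 4) : ℝ :=
  ∑ r, ∑ s, ∑ t, sgn4 r * sgn4 s * sgn4 t * C a r s t * C b r s t

theorem belT_eq (C : Fin 4 → Fin 4 → Fin 4 → Fin 4 → ℝ)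
    (h3 : ∀ a b c d, C a b c d = C c d a b) (a b l m : Fin 4) :
    belT 4 C a b l m = dcon C a b l m + dcon C a b m l
      - (1 / 2) * gmet 4 a b * tcon C l m - (1 / 2) * gmet 4 l m * tcon C a b
      + (1 / 8) * gmet 4 a b * gmet 4 l m * ∑ r, sgn4 r * tcon C r r := by
  have e : (∑ r, ∑ t, ∑ s, sgn4 r * sgn4 t * sgn4 s * C r t l s * C r t m s) = tcon C l m := by
    simp only [h3 _ _ l, h3 _ _ m]
    unfold tcon
    calc _ = ∑ r, ∑ s, ∑ t, sgn4 r * sgn4 t * sgn4 s * C l s r t * C m s r t :=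
          Finset.sum_congr rfl fun _ _ => Finset.sum_comm
      _ = ∑ s, ∑ r, ∑ t, sgn4 r * sgn4 t * sgn4 s * C l s r t * C m s r t := Finset.sum_comm
      _ = _ := by
          refine Finset.sum_congr rfl fun _ _ => Finset.sum_congr rfl fun _ _ =>
            Finset.sum_congr rfl fun _ _ => by ring
  rw [← e]
  unfold belT
  simp only [gmet_eq, dcon, tcon, ite_mul, mul_ite, zero_mul, mul_zero, Finset.sum_ite_eq,
    Finset.mem_univ, if_true, Finset.sum_ite_irrel, Finset.sum_const_zero, Finset.mul_sum, mul_assoc]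

theorem forall_fin4 {P : Fin 4 → Prop} (h0 : P 0) (h1 : P 1) (h2 : P 2) (h3 : P 3) :
    ∀ i, P i := by
  intro i; fin_cases i <;> assumption

set_option linter.unusedSimpArgs false in
set_option maxHeartbeats 20000000 in
theorem main4 (C : Fin 4 → Fin 4 → Fin 4 → Fin 4 → ℝ) (hC : IsWeylCandidate 4 C) :
    (∀ a b, tcon C a b = gmet 4 a b * tcon C 1 1) ∧
    (∀ a b l m, dcon C a b l m + dcon C a b m l
        - (1 / 2) * gmet 4 a b * gmet 4 l m * tcon C 1 1
      = dcon C a l b m + dcon C a l m b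
        - (1 / 2) * gmet 4 a l * gmet 4 b m * tcon C 1 1) := by
  obtain ⟨h1, h2, h3, h4, h5⟩ := hC
  have z1 : ∀ a c d, C a a c d = 0 := fun a c d => by linarith [h1 a a c d]
  have z2 : ∀ a c d, C c d a a = 0 := fun a c d => by linarith [h2 c d a a]
  simp only [gmet, Fin.sum_univ_four] at h5
  norm_num [Fin.ext_iff] at h5
  have a10 := h1 1 0
  have a20 := h1 2 0
  have a30 := h1 3 0
  have a21 := h1 2 1
  have a31 := h1 3 1
  have a32 := h1 3 2
  have b10 := fun a b => h2 a b 1 0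
  have b20 := fun a b => h2 a b 2 0
  have b30 := fun a b => h2 a b 3 0
  have b21 := fun a b => h2 a b 2 1
  have b31 := fun a b => h2 a b 3 1
  have b32 := fun a b => h2 a b 3 2
  have c1 := h3 0 2 0 1
  have c2 := h3 0 3 0 1
  have c3 := h3 1 2 0 1
  have c4 := h3 1 3 0 1
  have c5 := h3 2 3 0 1
  have c6 := h3 0 3 0 2
  have c7 := h3 1 2 0 2
  have c8 := h3 1 3 0 2
  have c9 := h3 2 3 0 2
  have c10 := h3 1 2 0 3
  have c11 := h3 1 3 0 3
  have c12 := h3 2 3 0 3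
  have c13 := h3 1 3 1 2
  have c14 := h3 2 3 1 2
  have c15 := h3 2 3 1 3
  have t00 := h5 0 0
  have t11 := h5 1 1
  have t22 := h5 2 2
  have t33 := h5 3 3
  have t01 := h5 0 1
  have t02 := h5 0 2
  have t03 := h5 0 3
  have t12 := h5 1 2
  have t13 := h5 1 3
  have t23 := h5 2 3
  have bi := h4 0 1 2 3
  simp only [z1, z2, a10, a20, a30, a21, a31, a32, b10, b20, b30, b21, b31, b32, c1, c2, c3, c4,
    c5, c6, c7, c8, c9, c10, c11, c12, c13, c14, c15] at t00 t11 t22 t33 t01 t02 t03 t12 t13 t23 bi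
  have d1 : C 0 3 0 3 = - C 0 1 0 1 - C 0 2 0 2 := by linarith
  have d2 : C 2 3 2 3 = - C 0 1 0 1 := by linarith
  have d3 : C 1 3 1 3 = - C 0 2 0 2 := by linarith
  have d4 : C 1 2 1 2 = C 0 1 0 1 + C 0 2 0 2 := by linarith
  have d5 : C 1 3 2 3 = C 0 1 0 2 := by linarith
  have d6 : C 1 2 2 3 = - C 0 1 0 3 := by linarith
  have d7 : C 1 2 1 3 = C 0 2 0 3 := by linarith
  have d8 : C 0 3 1 3 = - C 0 2 1 2 := by linarith
  have d9 : C 0 3 2 3 = C 0 1 1 2 := by linarith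
  have d10 : C 0 2 2 3 = - C 0 1 1 3 := by linarith
  have d11 : C 0 3 1 2 = C 0 2 1 3 - C 0 1 2 3 := by linarith
  clear t00 t11 t22 t33 t01 t02 t03 t12 t13 t23 bi h1 h2 h3 h4 h5
  have s0 : sgn4 0 = -1 := by norm_num [sgn4]
  have s1 : sgn4 1 = 1 := by norm_num [sgn4]
  have s2 : sgn4 2 = 1 := by norm_num [sgn4]
  have s3 : sgn4 3 = 1 := by norm_num [sgn4]
  have k1 : tcon C 1 1 = 2 * (- C 0 1 0 1 ^ 2 - C 0 2 0 2 ^ 2 - (C 0 1 0 1 + C 0 2 0 2) ^ 2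
      - 2 * C 0 1 0 2 ^ 2 - 2 * C 0 1 0 3 ^ 2 - 2 * C 0 2 0 3 ^ 2) * (-1)
      - 2 * (C 0 1 2 3 ^ 2 + C 0 2 1 3 ^ 2 + (C 0 2 1 3 - C 0 1 2 3) ^ 2
      + 2 * C 0 1 1 2 ^ 2 + 2 * C 0 1 1 3 ^ 2 + 2 * C 0 2 1 2 ^ 2) := by
    simp only [tcon, Fin.sum_univ_four, s0, s1, s2, s3, z1, z2, a10, a20, a30, a21, a31, a32,
      b10, b20, b30, b21, b31, b32, c1, c2, c3, c4,
      c5, c6, c7, c8, c9, c10, c11, c12, c13, c14, c15,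
      d1, d2, d3, d4, d5, d6, d7, d8, d9, d10, d11]
    ring
  constructor
  · rw [k1]
    refine forall_fin4 ?_ ?_ ?_ ?_ <;> refine forall_fin4 ?_ ?_ ?_ ?_ <;>
    · simp only [tcon, gmet_eq, Fin.sum_univ_four, s0, s1, s2, s3, z1, z2, a10, a20, a30, a21, a31,
        a32, b10, b20, b30, b21, b31, b32, c1, c2, c3, c4,
        c5, c6, c7, c8, c9, c10, c11, c12, c13, c14, c15,
        d1, d2, d3, d4, d5, d6, d7, d8, d9, d10, d11, Fin.isValue, Fin.reduceEq, if_true, if_false,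
        mul_zero, zero_mul, neg_zero, add_zero, zero_add]
      ring
  · rw [k1]
    refine forall_fin4 ?_ ?_ ?_ ?_ <;> refine forall_fin4 ?_ ?_ ?_ ?_ <;>
    refine forall_fin4 ?_ ?_ ?_ ?_ <;> refine forall_fin4 ?_ ?_ ?_ ?_ <;>
    · simp only [dcon, gmet_eq, Fin.sum_univ_four, s0, s1, s2, s3, z1, z2, a10, a20, a30, a21, a31,
        a32, b10, b20, b30, b21, b31, b32, c1, c2, c3, c4,
        c5, c6, c7, c8, c9, c10, c11, c12, c13, c14, c15,
        d1, d2, d3, d4, d5, d6, d7, d8, d9, d10, d11, Fin.isValue, Fin.reduceEq, if_true, if_false,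
        mul_zero, zero_mul, neg_zero, add_zero, zero_add]
      try ring

theorem belT_four (C : Fin 4 → Fin 4 → Fin 4 → Fin 4 → ℝ) (hC : IsWeylCandidate 4 C)
    (a b l m : Fin 4) :
    belT 4 C a b l m = dcon C a b l m + dcon C a b m l
        - (1 / 2) * gmet 4 a b * gmet 4 l m * tcon C 1 1 := by
  have hs : ∑ r, sgn4 r * tcon C r r = 4 * tcon C 1 1 := by
    have h := (main4 C hC).1
    rw [Fin.sum_univ_four, h 0 0, h 2 2, h 3 3]
    norm_num [gmet, sgn4]
    ring
  rw [belT_eq C hC.2.2.1, hs, (main4 C hC).1 a b, (main4 C hC).1 l m]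
  ring

theorem gmet_comm (a b : Fin 4) : gmet 4 a b = gmet 4 b a := by
  by_cases h : a = b
  · rw [h]
  · simp [gmet, h, Ne.symm h]

theorem dcon_comm (C : Fin 4 → Fin 4 → Fin 4 → Fin 4 → ℝ) (a b l m : Fin 4) :
    dcon C a b l m = dcon C b a m l :=
  Finset.sum_congr rfl fun _ _ => Finset.sum_congr rfl fun _ _ => by ring

/-- in dimension 4, the generalized Bel–Robinson tensor of a Weyl candidate
is completely symmetric (invariant under every permutation of its four indices). -/
theorem belRobinson_completely_symmetric_dim4
    (C : Fin 4 → Fin 4 → Fin 4 → Fin 4 → ℝ) (hC : IsWeylCandidate 4 C) :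
    ∀ (π : Equiv.Perm (Fin 4)) (v : Fin 4 → Fin 4),
      belT 4 C (v (π 0)) (v (π 1)) (v (π 2)) (v (π 3))
        = belT 4 C (v 0) (v 1) (v 2) (v 3) := by
  intro π
  have hm : π ∈ Submonoid.closure
      (Set.range fun i : Fin 3 => Equiv.swap i.castSucc i.succ) := by
    rw [Equiv.Perm.mclosure_swap_castSucc_succ]; trivial
  induction hm using Submonoid.closure_induction with
  | one => intro v; rfl
  | mul x y _ _ hx hy =>
    intro v
    have h := hy (fun i => v (x i))
    simp only [Equiv.Perm.mul_apply]
    exact h.trans (hx v)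
  | mem x hx =>
    obtain ⟨i, rfl⟩ := hx
    intro v
    fin_cases i
    · change belT 4 C (v 1) (v 0) (v 2) (v 3) = _
      rw [belT_four C hC, belT_four C hC, gmet_comm (v 1), dcon_comm C (v 1),
        dcon_comm C (v 1) (v 0) (v 3)]
      ring
    · change belT 4 C (v 0) (v 2) (v 1) (v 3) = _
      rw [belT_four C hC, belT_four C hC]
      exact (main4 C hC).2 _ _ _ _
    · change belT 4 C (v 0) (v 1) (v 3) (v 2) = _
      rw [belT_four C hC, belT_four C hC, gmet_comm (v 3)]
      ring
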